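/- For every k ∈ {1,…,d} and every r ∈ ℕ₀, the following identity of bounded operators on ℓ²(ℕ^d) holds: x_k x_k* (x_k*)^r = (x_k*)^r (y_{k0}(I − (r+1)y_{r+1}) + (r+1)y_{r+1}) y_{r+1}. -/

import Mathlib

noncomputable section

/-- The Hilbert space `ℓ²(ℕ^d)`. -/
abbrev L2 (d : ℕ) := lp (fun _ : Fin d → ℕ => ℂ) 2

/-- Bounded operators on `ℓ²(ℕ^d)`. -/
abbrev BdOp (d : ℕ) := L2 d →L[ℂ] L2 d

/-- The standard basis vector `e_𝔫` of `ℓ²(ℕ^d)`. -/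
def e2 (d : ℕ) (n : Fin d → ℕ) : L2 d := lp.single 2 n (1 : ℂ)

/-- The total degree `|𝔫| = n₁ + ⋯ + n_d`. -/
def degIdx (d : ℕ) (n : Fin d → ℕ) : ℕ := ∑ k, n k

/-- `xop k` is the continuous extension of `a_k (N+α)⁻¹`:
`e_𝔫 ↦ (√(n_k)/(|𝔫|+α)) e_{𝔫−1_k}` (zero when `n_k = 0`). -/
def IsXk (d : ℕ) (α : ℝ) (xop : Fin d → BdOp d) : Prop :=
  ∀ (k : Fin d) (n : Fin d → ℕ),
    xop k (e2 d n) =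
      ((Real.sqrt (n k) / ((degIdx d n : ℝ) + α) : ℝ) : ℂ) •
        e2 d (Function.update n k (n k - 1))

/-- `yop m` is the diagonal operator `y_m = (N+α+m)⁻¹`:
`e_𝔫 ↦ (|𝔫|+α+m)⁻¹ e_𝔫`. -/
def IsYm (d : ℕ) (α : ℝ) (yop : ℤ → BdOp d) : Prop :=
  ∀ (m : ℤ) (n : Fin d → ℕ),
    yop m (e2 d n) = ((((degIdx d n : ℝ) + α + m)⁻¹ : ℝ) : ℂ) • e2 d n

/-- The operator `x^𝔫 = x₁^{n₁} ⋯ x_d^{n_d}`. -/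
def xPow (d : ℕ) (xop : Fin d → BdOp d) (n : Fin d → ℕ) : BdOp d :=
  (List.ofFn fun j : Fin d => xop j ^ n j).prod

/-- `ykop k` is the diagonal operator `y_{k0}`, the continuous extension of
`N_k (N+α)⁻¹`: `e_𝔫 ↦ (n_k/(|𝔫|+α)) e_𝔫`. -/
def IsYk0 (d : ℕ) (α : ℝ) (ykop : Fin d → BdOp d) : Prop :=
  ∀ (k : Fin d) (n : Fin d → ℕ),
    ykop k (e2 d n) =
      (((n k : ℝ) / ((degIdx d n : ℝ) + α) : ℝ) : ℂ) • e2 d n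

/-- Bounded operators on `ℓ²(ℕ^d)` agreeing on the standard basis are equal. -/
theorem BdOp.ext_e2 {d : ℕ} {S T : BdOp d} (h : ∀ n, S (e2 d n) = T (e2 d n)) : S = T := by
  ext1 f
  have hf := lp.hasSum_single (by simp : (2 : ENNReal) ≠ ⊤) f
  have key : ∀ n, S (lp.single 2 n (f n)) = T (lp.single 2 n (f n)) := by
    intro n
    have hn : lp.single 2 n (f n) = f n • e2 d n := by
      rw [e2, ← lp.single_smul, smul_eq_mul, mul_one]
    rw [hn, map_smul, map_smul, h]
  have hS := hf.mapL S
  simp only [key] at hS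
  exact hS.unique (hf.mapL T)

theorem degIdx_update_succ {d : ℕ} (n : Fin d → ℕ) (k : Fin d) (r : ℕ) :
    degIdx d (Function.update n k (n k + r)) = degIdx d n + r := by
  simp only [degIdx]
  rw [Finset.sum_update_of_mem (Finset.mem_univ k),
    ← Finset.add_sum_erase _ n (Finset.mem_univ k), Finset.sdiff_singleton_eq_erase]
  ring

theorem inner_e2_left {d : ℕ} (n : Fin d → ℕ) (f : L2 d) : inner ℂ (e2 d n) f = f n := by
  rw [e2, lp.inner_single_left]
  simp

theorem e2_apply {d : ℕ} (n m : Fin d → ℕ) : e2 d n m = if m = n then 1 else 0 := by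
  simp [e2, lp.single_apply, Pi.single_apply]

/-- The adjoint of `x_k` is the weighted raising operator
`e_𝔫 ↦ (√(n_k+1)/(|𝔫|+1+α)) e_{𝔫+1_k}`. -/
theorem IsXk.star_apply {d : ℕ} {α : ℝ} {xop : Fin d → BdOp d} (hx : IsXk d α xop)
    (k : Fin d) (n : Fin d → ℕ) :
    star (xop k) (e2 d n) =
      ((Real.sqrt ((n k + 1 : ℕ) : ℝ) / (((degIdx d n + 1 : ℕ) : ℝ) + α) : ℝ) : ℂ) •
        e2 d (Function.update n k (n k + 1)) := by
  ext m
  rw [← inner_e2_left, ContinuousLinearMap.star_eq_adjoint,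
    ContinuousLinearMap.adjoint_inner_right, hx, inner_smul_left, inner_e2_left,
    Complex.conj_ofReal, e2_apply, lp.coeFn_smul, Pi.smul_apply, e2_apply, smul_eq_mul]
  by_cases hm : m = Function.update n k (n k + 1)
  · subst hm
    simp [degIdx_update_succ]
  · rw [if_neg hm, mul_zero, mul_eq_zero, or_iff_not_imp_right]
    intro h
    have hn : n = Function.update m k (m k - 1) := by
      by_contra hne
      exact h (if_neg (Ne.symm hne))
    have hmk : m k = 0 := by
      by_contra h0
      apply hm
      subst hn
      simp [Nat.sub_add_cancel (Nat.pos_of_ne_zero h0)]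
    simp [hmk]

theorem IsXk.star_pow_apply {d : ℕ} {α : ℝ} {xop : Fin d → BdOp d} (hx : IsXk d α xop)
    (k : Fin d) (n : Fin d → ℕ) (r : ℕ) :
    ∃ c : ℂ, (star (xop k) ^ r) (e2 d n) = c • e2 d (Function.update n k (n k + r)) := by
  induction r with
  | zero => exact ⟨1, by simp⟩
  | succ r ih =>
    obtain ⟨c, hc⟩ := ih
    rw [pow_succ', mul_apply_eq_comp, hc, map_smul, hx.star_apply, smul_smul,
      Function.update_idem, Function.update_self, add_assoc (n k)]
    exact ⟨_, rfl⟩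

/-- `x_k x_k*` is diagonal with eigenvalues `(n_k+1)/(|𝔫|+1+α)²`. -/
theorem IsXk.mul_star_apply {d : ℕ} {α : ℝ} {xop : Fin d → BdOp d} (hx : IsXk d α xop)
    (k : Fin d) (n : Fin d → ℕ) :
    (xop k * star (xop k)) (e2 d n) =
      ((((n k : ℝ) + 1) / ((degIdx d n : ℝ) + 1 + α) ^ 2 : ℝ) : ℂ) • e2 d n := by
  rw [mul_apply_eq_comp, hx.star_apply, map_smul, hx, smul_smul,
    degIdx_update_succ, ← Complex.ofReal_mul]
  simp only [Function.update_self, Function.update_idem, Nat.add_sub_cancel,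
    Function.update_eq_self]
  rw [div_mul_div_comm, Real.mul_self_sqrt (Nat.cast_nonneg _)]
  push_cast
  rw [sq]

/-- Lemma 4.1(ii): for `k = 1, …, d` and `r ∈ ℕ₀`,
`x_k x_k* (x_k*)^r = (x_k*)^r (y_{k0}(I − (r+1)y_{r+1}) + (r+1)y_{r+1}) y_{r+1}`
as bounded operators on `ℓ²(ℕ^d)`. -/
theorem stmt15 (d : ℕ) (hd : 1 ≤ d) (α : ℝ) (hα : 0 < α)
    (hαint : ∀ z : ℤ, α ≠ (z : ℝ))
    (xop : Fin d → BdOp d) (hx : IsXk d α xop)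
    (yop : ℤ → BdOp d) (hy : IsYm d α yop)
    (ykop : Fin d → BdOp d) (hyk : IsYk0 d α ykop)
    (k : Fin d) (r : ℕ) :
    xop k * star (xop k) * (star (xop k)) ^ r =
      (star (xop k)) ^ r *
        (ykop k * ((1 : BdOp d) - (((r : ℝ) + 1 : ℝ) : ℂ) • yop ((r : ℤ) + 1)) +
          (((r : ℝ) + 1 : ℝ) : ℂ) • yop ((r : ℤ) + 1)) *
        yop ((r : ℤ) + 1) := by
  apply BdOp.ext_e2
  intro n
  obtain ⟨c, hc⟩ := hx.star_pow_apply k n r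
  have hM : (degIdx d n : ℝ) + α ≠ 0 := by positivity
  have hMr : (degIdx d n : ℝ) + α + ((r : ℝ) + 1) ≠ 0 := by positivity
  have hMr' : (degIdx d n : ℝ) + r + 1 + α ≠ 0 := by positivity
  have hdiag : ((ykop k * ((1 : BdOp d) - (((r : ℝ) + 1 : ℝ) : ℂ) • yop ((r : ℤ) + 1)) +
      (((r : ℝ) + 1 : ℝ) : ℂ) • yop ((r : ℤ) + 1)) * yop ((r : ℤ) + 1)) (e2 d n) =
      ((((n k : ℝ) + r + 1) / ((degIdx d n : ℝ) + r + 1 + α) ^ 2 : ℝ) : ℂ) • e2 d n := by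
    simp only [mul_apply_eq_comp, add_apply,
      sub_apply, smul_apply,
      one_apply_eq_self, map_sub, map_smul, hy _ n, hyk k n, smul_smul,
      ← sub_smul, ← add_smul]
    congr 1
    norm_cast
    push_cast
    field_simp
    ring
  rw [mul_assoc (star (xop k) ^ r), mul_apply_eq_comp (star (xop k) ^ r), hdiag,
    map_smul, mul_apply_eq_comp (xop k * star (xop k)), hc, map_smul,
    hx.mul_star_apply, degIdx_update_succ, Function.update_self, smul_comm c]
  push_cast
  rfl
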